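/- Let l ≥ 2 be an integer, let u : ℝ^n → ℝ be smooth (C^∞) with compact support, and let α ∈ {1, …, n}. Then ∫_{ℝ^n} x_α·(Δu)·∂(Δ^{l−2}u)/∂x_α = ∫_{ℝ^n} [ (l−3)·(∂(Δ^{l−2}u)/∂x_α)·(∂u/∂x_α) − (1/2)·u·Δ^{l−1}u ], where Δ is the Euclidean Laplacian and x_α the α-th coordinate function. -/

import Mathlib

open MeasureTheory

/-- The Euclidean Laplacian of a function on `ℝⁿ`. -/
noncomputable def lap {n : ℕ} (f : EuclideanSpace ℝ (Fin n) → ℝ) : EuclideanSpace ℝ (Fin n) → ℝ :=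
  fun x => ∑ i : Fin n,
    fderiv ℝ (fun y => fderiv ℝ f y (EuclideanSpace.single i 1)) x (EuclideanSpace.single i 1)

/-- The partial derivative of a function on `ℝⁿ` in the `i`-th coordinate direction. -/
noncomputable def pderiv {n : ℕ} (i : Fin n) (f : EuclideanSpace ℝ (Fin n) → ℝ) :
    EuclideanSpace ℝ (Fin n) → ℝ :=
  fun x => fderiv ℝ f x (EuclideanSpace.single i 1)

section Derivatives

variable {n : ℕ} {f g : EuclideanSpace ℝ (Fin n) → ℝ}

theorem lap_eq_sum_pderiv (f : EuclideanSpace ℝ (Fin n) → ℝ) :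
    lap f = fun x => ∑ i, pderiv i (pderiv i f) x := rfl

theorem contDiff_pderiv (hf : ContDiff ℝ (⊤ : ℕ∞) f) (i : Fin n) :
    ContDiff ℝ (⊤ : ℕ∞) (pderiv i f) :=
  (hf.fderiv_right (m := (⊤ : ℕ∞)) (by simp)).clm_apply contDiff_const

theorem hasCompactSupport_pderiv (hf : HasCompactSupport f) (i : Fin n) :
    HasCompactSupport (pderiv i f) :=
  hf.fderiv_apply ℝ _

theorem contDiff_lap (hf : ContDiff ℝ (⊤ : ℕ∞) f) : ContDiff ℝ (⊤ : ℕ∞) (lap f) :=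
  ContDiff.sum fun i _ => contDiff_pderiv (contDiff_pderiv hf i) i

theorem hasCompactSupport_lap (hf : HasCompactSupport f) : HasCompactSupport (lap f) := by
  refine hf.mono' fun x hx => ?_
  by_contra h
  refine hx (Finset.sum_eq_zero fun i _ => ?_)
  by_contra h'
  exact h (tsupport_fderiv_apply_subset ℝ _ (tsupport_fderiv_apply_subset ℝ _
    (subset_tsupport _ h')))

theorem contDiff_lap_iterate (hf : ContDiff ℝ (⊤ : ℕ∞) f) (k : ℕ) :
    ContDiff ℝ (⊤ : ℕ∞) (lap^[k] f) :=
  Function.Iterate.rec _ hf (fun _ => contDiff_lap) k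

theorem hasCompactSupport_lap_iterate (hf : HasCompactSupport f) (k : ℕ) :
    HasCompactSupport (lap^[k] f) :=
  Function.Iterate.rec _ hf (fun _ => hasCompactSupport_lap) k

theorem contDiff_coord (α : Fin n) :
    ContDiff ℝ (⊤ : ℕ∞) fun x : EuclideanSpace ℝ (Fin n) => x α := by
  fun_prop

theorem pderiv_add (hf : ContDiff ℝ (⊤ : ℕ∞) f) (hg : ContDiff ℝ (⊤ : ℕ∞) g) (i : Fin n) :
    pderiv i (fun x => f x + g x) = fun x => pderiv i f x + pderiv i g x := by
  funext x
  simp only [pderiv]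
  rw [fderiv_fun_add (hf.differentiable (by simp) x) (hg.differentiable (by simp) x)]
  rfl

theorem pderiv_const_mul (hf : ContDiff ℝ (⊤ : ℕ∞) f) (c : ℝ) (i : Fin n) :
    pderiv i (fun x => c * f x) = fun x => c * pderiv i f x := by
  funext x
  simp only [pderiv]
  rw [fderiv_const_mul (hf.differentiable (by simp) x)]
  rfl

theorem pderiv_sum {ι : Type*} (s : Finset ι) {F : ι → EuclideanSpace ℝ (Fin n) → ℝ}
    (hF : ∀ j ∈ s, ContDiff ℝ (⊤ : ℕ∞) (F j)) (i : Fin n) :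
    pderiv i (fun x => ∑ j ∈ s, F j x) = fun x => ∑ j ∈ s, pderiv i (F j) x := by
  funext x
  simp only [pderiv]
  rw [fderiv_fun_sum fun j hj => (hF j hj).differentiable (by simp) x]
  simp

theorem pderiv_coord_mul (hf : ContDiff ℝ (⊤ : ℕ∞) f) (α i : Fin n) :
    pderiv i (fun x => x α * f x) =
      fun x => x α * pderiv i f x + (if i = α then 1 else 0) * f x := by
  funext x
  have hx : HasFDerivAt (fun y : EuclideanSpace ℝ (Fin n) => y α)
      (EuclideanSpace.proj α : EuclideanSpace ℝ (Fin n) →L[ℝ] ℝ) x :=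
    (EuclideanSpace.proj α : EuclideanSpace ℝ (Fin n) →L[ℝ] ℝ).hasFDerivAt
  simp only [pderiv]
  rw [(hx.fun_mul (hf.differentiable (by simp) x).hasFDerivAt).fderiv]
  simp [eq_comm, mul_comm]

theorem pderiv_comm (hf : ContDiff ℝ (⊤ : ℕ∞) f) (i j : Fin n) :
    pderiv i (pderiv j f) = pderiv j (pderiv i f) := by
  funext x
  have hd : DifferentiableAt ℝ (fderiv ℝ f) x :=
    (hf.fderiv_right (m := (⊤ : ℕ∞)) (by simp)).differentiable (by simp) x
  have hsymm : IsSymmSndFDerivAt ℝ f x :=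
    hf.contDiffAt.isSymmSndFDerivAt (by simpa using WithTop.coe_le_coe.2 (le_top (a := (2 : ℕ∞))))
  have key (a b : EuclideanSpace ℝ (Fin n)) :
      fderiv ℝ (fun y => fderiv ℝ f y a) x b = fderiv ℝ (fderiv ℝ f) x b a := by
    rw [fderiv_clm_apply hd (differentiableAt_const a)]
    simp
  exact (key _ _).trans ((hsymm _ _).trans (key _ _).symm)

theorem lap_pderiv (hf : ContDiff ℝ (⊤ : ℕ∞) f) (α : Fin n) :
    lap (pderiv α f) = pderiv α (lap f) := by
  simp only [lap_eq_sum_pderiv]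
  rw [pderiv_sum _ fun i _ => contDiff_pderiv (contDiff_pderiv hf i) i]
  funext x
  refine Finset.sum_congr rfl fun i _ => ?_
  rw [pderiv_comm hf i α, pderiv_comm (contDiff_pderiv hf i) i α]

theorem lap_iterate_pderiv (hf : ContDiff ℝ (⊤ : ℕ∞) f) (α : Fin n) (k : ℕ) :
    lap^[k] (pderiv α f) = pderiv α (lap^[k] f) := by
  induction k with
  | zero => rfl
  | succ k ih =>
    rw [Function.iterate_succ_apply', ih, lap_pderiv (contDiff_lap_iterate hf k),
      Function.iterate_succ_apply']

theorem lap_add_const_mul (hf : ContDiff ℝ (⊤ : ℕ∞) f) (hg : ContDiff ℝ (⊤ : ℕ∞) g) (c : ℝ) :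
    lap (fun x => f x + c * g x) = fun x => lap f x + c * lap g x := by
  have key {f g : EuclideanSpace ℝ (Fin n) → ℝ} (hf : ContDiff ℝ (⊤ : ℕ∞) f)
      (hg : ContDiff ℝ (⊤ : ℕ∞) g) (i : Fin n) :
      pderiv i (fun x => f x + c * g x) = fun x => pderiv i f x + c * pderiv i g x := by
    rw [pderiv_add hf (contDiff_const.mul hg), pderiv_const_mul hg]
  funext x
  simp only [lap_eq_sum_pderiv, Finset.mul_sum, ← Finset.sum_add_distrib]
  refine Finset.sum_congr rfl fun i _ => ?_
  rw [key hf hg, key (contDiff_pderiv hf i) (contDiff_pderiv hg i)]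

theorem lap_coord_mul (hf : ContDiff ℝ (⊤ : ℕ∞) f) (α : Fin n) :
    lap (fun x => x α * f x) = fun x => x α * lap f x + 2 * pderiv α f x := by
  have key (i : Fin n) : pderiv i (pderiv i fun x => x α * f x) = fun x =>
      x α * pderiv i (pderiv i f) x + if i = α then 2 * pderiv i f x else 0 := by
    rw [pderiv_coord_mul hf, pderiv_add ((contDiff_coord α).mul (contDiff_pderiv hf i))
      (contDiff_const.mul hf), pderiv_coord_mul (contDiff_pderiv hf i), pderiv_const_mul hf]
    funext x
    split_ifs <;> ring
  funext x
  simp only [lap_eq_sum_pderiv, key, Finset.sum_add_distrib, ← Finset.mul_sum]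
  simp

theorem lap_iterate_coord_mul_lap (hf : ContDiff ℝ (⊤ : ℕ∞) f) (α : Fin n) (k : ℕ) :
    lap^[k] (fun x => x α * lap f x) =
      fun x => x α * (lap^[k + 1] f) x + 2 * k * pderiv α (lap^[k] f) x := by
  induction k with
  | zero => simp
  | succ k ih =>
    have hk := contDiff_lap_iterate hf k
    have hk' := contDiff_lap_iterate hf (k + 1)
    rw [Function.iterate_succ_apply', ih,
      lap_add_const_mul ((contDiff_coord α).mul hk') (contDiff_pderiv hk α),
      lap_coord_mul hk', lap_pderiv hk]
    funext x
    simp only [← Function.iterate_succ_apply' lap]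
    push_cast
    ring

end Derivatives

section Integrals

variable {n : ℕ} {f g : EuclideanSpace ℝ (Fin n) → ℝ}

theorem integrable_mul_of_contDiff (hf : ContDiff ℝ (⊤ : ℕ∞) f) (hg : ContDiff ℝ (⊤ : ℕ∞) g)
    (hgs : HasCompactSupport g) : Integrable fun x => f x * g x :=
  (hf.continuous.mul hg.continuous).integrable_of_hasCompactSupport hgs.mul_left

theorem integral_mul_pderiv (hf : ContDiff ℝ (⊤ : ℕ∞) f) (hg : ContDiff ℝ (⊤ : ℕ∞) g)
    (hgs : HasCompactSupport g) (i : Fin n) :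
    ∫ x, f x * pderiv i g x = -∫ x, pderiv i f x * g x :=
  integral_mul_fderiv_eq_neg_fderiv_mul_of_integrable
    (integrable_mul_of_contDiff (contDiff_pderiv hf i) hg hgs)
    (integrable_mul_of_contDiff hf (contDiff_pderiv hg i) (hasCompactSupport_pderiv hgs i))
    (integrable_mul_of_contDiff hf hg hgs)
    (fun x _ => hf.differentiable (by simp) x) (fun x _ => hg.differentiable (by simp) x)

theorem integral_mul_lap (hf : ContDiff ℝ (⊤ : ℕ∞) f) (hg : ContDiff ℝ (⊤ : ℕ∞) g)
    (hgs : HasCompactSupport g) :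
    ∫ x, f x * lap g x = ∫ x, lap f x * g x := by
  simp only [lap_eq_sum_pderiv, Finset.mul_sum, Finset.sum_mul]
  rw [integral_finsetSum _ fun i _ => integrable_mul_of_contDiff hf
      (contDiff_pderiv (contDiff_pderiv hg i) i)
      (hasCompactSupport_pderiv (hasCompactSupport_pderiv hgs i) i),
    integral_finsetSum _ fun i _ => integrable_mul_of_contDiff
      (contDiff_pderiv (contDiff_pderiv hf i) i) hg hgs]
  refine Finset.sum_congr rfl fun i _ => ?_
  rw [integral_mul_pderiv hf (contDiff_pderiv hg i) (hasCompactSupport_pderiv hgs i),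
    integral_mul_pderiv (contDiff_pderiv hf i) hg hgs, neg_neg]

theorem integral_mul_lap_iterate (hf : ContDiff ℝ (⊤ : ℕ∞) f) (hg : ContDiff ℝ (⊤ : ℕ∞) g)
    (hgs : HasCompactSupport g) (k : ℕ) :
    ∫ x, f x * (lap^[k] g) x = ∫ x, (lap^[k] f) x * g x := by
  induction k generalizing f with
  | zero => rfl
  | succ k ih =>
    rw [Function.iterate_succ_apply', integral_mul_lap hf (contDiff_lap_iterate hg k)
      (hasCompactSupport_lap_iterate hgs k), ih (contDiff_lap hf), Function.iterate_succ_apply]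

end Integrals

theorem integral_coord_mul_lap_mul_deriv_lap_iterate {n : ℕ} (l : ℕ) (hl : 2 ≤ l)
    (u : EuclideanSpace ℝ (Fin n) → ℝ)
    (hu : ContDiff ℝ (⊤ : ℕ∞) u) (hsupp : HasCompactSupport u) (α : Fin n) :
    ∫ x, x α * lap u x * fderiv ℝ (lap^[l - 2] u) x (EuclideanSpace.single α 1) =
      ∫ x, (((l : ℝ) - 3) *
          (fderiv ℝ (lap^[l - 2] u) x (EuclideanSpace.single α 1) *
            fderiv ℝ u x (EuclideanSpace.single α 1)) -
        (1 / 2) * u x * (lap^[l - 1] u) x) := by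
  obtain ⟨k, rfl⟩ := Nat.exists_eq_add_of_le' hl
  have hk := contDiff_lap_iterate hu k
  have hks := hasCompactSupport_lap_iterate hsupp k
  have hk' := contDiff_lap_iterate hu (k + 1)
  have hks' := hasCompactSupport_lap_iterate hsupp (k + 1)
  have hx := contDiff_coord α
  have hDu := contDiff_pderiv hu α
  have hDus := hasCompactSupport_pderiv hsupp α
  have hDk := contDiff_pderiv hk α
  have hDks := hasCompactSupport_pderiv hks α
  have hT := integrable_mul_of_contDiff hDk hDu hDus
  have hU := integrable_mul_of_contDiff hu hk' hks'
  have h₁ : ∫ x, x α * lap u x * pderiv α (lap^[k] u) x =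
      (∫ x, x α * (lap^[k + 1] u) x * pderiv α u x) +
        2 * k * ∫ x, pderiv α (lap^[k] u) x * pderiv α u x := by
    have h := integral_mul_lap_iterate (hx.mul (contDiff_lap hu)) hDu hDus k
    rw [lap_iterate_pderiv hu, lap_iterate_coord_mul_lap hu] at h
    refine h.trans ?_
    rw [← integral_const_mul,
      ← integral_add (integrable_mul_of_contDiff (hx.mul hk') hDu hDus) (hT.const_mul _)]
    congr 1 with x
    ring
  have h₂ : ∫ x, x α * (lap^[k + 1] u) x * pderiv α u x =
      -(∫ x, x α * u x * lap (pderiv α (lap^[k] u)) x) - ∫ x, u x * (lap^[k + 1] u) x := by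
    rw [integral_mul_pderiv (hx.mul hk') hu hsupp, pderiv_coord_mul hk', lap_pderiv hk,
      ← Function.iterate_succ_apply' lap, ← neg_add', ← integral_add
        (integrable_mul_of_contDiff (hx.mul hu) (contDiff_pderiv hk' α)
          (hasCompactSupport_pderiv hks' α)) hU]
    congr 2 with x
    simp only [if_true]
    ring
  have h₃ : ∫ x, x α * u x * lap (pderiv α (lap^[k] u)) x =
      (∫ x, x α * lap u x * pderiv α (lap^[k] u) x) +
        2 * ∫ x, pderiv α (lap^[k] u) x * pderiv α u x := by
    rw [integral_mul_lap (hx.mul hu) hDk hDks, lap_coord_mul hu, ← integral_const_mul,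
      ← integral_add (integrable_mul_of_contDiff (hx.mul (contDiff_lap hu)) hDk hDks)
        (hT.const_mul _)]
    congr 1 with x
    ring
  change ∫ x, x α * lap u x * pderiv α (lap^[k] u) x =
    ∫ x, ((((k + 2 : ℕ) : ℝ) - 3) * (pderiv α (lap^[k] u) x * pderiv α u x) -
      (1 / 2) * u x * (lap^[k + 1] u) x)
  simp only [mul_assoc (1 / 2 : ℝ)]
  rw [integral_sub (hT.const_mul _) (hU.const_mul _), integral_const_mul, integral_const_mul]
  push_cast
  linarith
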